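/- Fix b, c, d ∈ ℂ and define, as functions of a, the quantities a' = (a+b+c+d)/2, b' = (a+b−c−d)/2, c' = (a−b+c−d)/2, d' = (−a+b+c−d)/2, a'' = (a+b+c−d)/2, b'' = (a+b−c+d)/2, c'' = (a−b+c+d)/2, d'' = (a−b−c−d)/2, and φ₂(a) = σ(a)σ(b)σ(c)σ(d) + σ(a')σ(b')σ(c')σ(d') + σ(a'')σ(b'')σ(c'')σ(d''). Then for all a ∈ ℂ, φ₂(a + 4ω₁) = e^{4η₁ a + 8η₁ ω₁} φ₂(a) and φ₂(a + 4ω₃) = e^{4η₃ a + 8η₃ ω₃} φ₂(a). -/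

import Mathlib

open Complex

/-- The lattice point `2nω₁ + 2mω₃` associated to `(n, m) ∈ ℤ²`. -/
noncomputable def latticePoint (ω₁ ω₃ : ℂ) (p : ℤ × ℤ) : ℂ :=
  2 * (p.1 : ℂ) * ω₁ + 2 * (p.2 : ℂ) * ω₃

/-- The Weierstrass sigma function with half-periods `ω₁, ω₃`,
`σ(z) = z ∏_{(n,m)≠(0,0)} (1 − z/w) exp(z/w + z²/(2w²))` with `w = 2nω₁ + 2mω₃`. -/
noncomputable def wSigma (ω₁ ω₃ z : ℂ) : ℂ :=
  z * ∏' p : {p : ℤ × ℤ // p ≠ (0, 0)},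
    (1 - z / latticePoint ω₁ ω₃ p.1) *
      Complex.exp (z / latticePoint ω₁ ω₃ p.1 + z ^ 2 / (2 * (latticePoint ω₁ ω₃ p.1) ^ 2))

/-- The half-periods `ω₁, ω₂ = −ω₁ − ω₃, ω₃` indexed by `j = 1, 2, 3`. -/
noncomputable def halfPeriod (ω₁ ω₃ : ℂ) : ℕ → ℂ
  | 1 => ω₁
  | 2 => -ω₁ - ω₃
  | 3 => ω₃
  | _ => 0

/-- The half-period values `η_j = σ'(ω_j)/σ(ω_j)`. -/
noncomputable def wEta (ω₁ ω₃ : ℂ) (j : ℕ) : ℂ :=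
  deriv (wSigma ω₁ ω₃) (halfPeriod ω₁ ω₃ j) / wSigma ω₁ ω₃ (halfPeriod ω₁ ω₃ j)


open Filter Topology

/-- The factor of the Weierstrass product belonging to the lattice point `w`; the point `w = 0`
contributes the factor `z`. -/
noncomputable def sigmaFactor (w z : ℂ) : ℂ :=
  if w = 0 then z else (1 - z / w) * exp (z / w + z ^ 2 / (2 * w ^ 2))

lemma norm_elementaryFactor_sub_one_le {u : ℂ} (hu : ‖u‖ ≤ 1 / 2) :
    ‖(1 - u) * exp (u + u ^ 2 / 2) - 1‖ ≤ 10 * ‖u‖ ^ 3 := by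
  set s := u + u ^ 2 / 2 with hs
  have hs_norm : ‖s‖ ≤ 5 / 4 * ‖u‖ := by
    calc ‖s‖ ≤ ‖u‖ + ‖u ^ 2 / 2‖ := norm_add_le _ _
      _ = ‖u‖ + ‖u‖ ^ 2 / 2 := by simp
      _ ≤ 5 / 4 * ‖u‖ := by nlinarith [norm_nonneg u]
  have hs_exp : ‖exp s - (1 + s + s ^ 2 / 2)‖ ≤ ‖s‖ ^ 3 := by
    have h := exp_bound (x := s) (by linarith) (n := 3) (by norm_num)
    simp only [Finset.sum_range_succ, Finset.sum_range_zero, Nat.factorial] at h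
    norm_num at h
    nlinarith [pow_nonneg (norm_nonneg s) 3]
  have hdecomp : (1 - u) * exp s - 1 = (1 - u) * (exp s - (1 + s + s ^ 2 / 2)) +
      u ^ 3 * (-1 + (1 - u) * (1 / 2 + u / 8)) := by
    rw [hs]; ring
  have h1 : ‖1 - u‖ ≤ 3 / 2 := (norm_sub_le _ _).trans (by norm_num; linarith)
  have h2 : ‖(1 / 2 + u / 8 : ℂ)‖ ≤ 1 := (norm_add_le _ _).trans (by norm_num; linarith)
  have h3 : ‖-1 + (1 - u) * (1 / 2 + u / 8)‖ ≤ 1 + 3 / 2 * 1 := by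
    refine (norm_add_le _ _).trans ?_
    rw [norm_mul, norm_neg, norm_one]
    gcongr
  calc ‖(1 - u) * exp s - 1‖
      ≤ 3 / 2 * (5 / 4 * ‖u‖) ^ 3 + ‖u‖ ^ 3 * (1 + 3 / 2 * 1) := by
        rw [hdecomp]
        refine (norm_add_le _ _).trans ?_
        rw [norm_mul, norm_mul, norm_pow]
        gcongr
        exact hs_exp.trans (by gcongr)
    _ ≤ 10 * ‖u‖ ^ 3 := by nlinarith [pow_nonneg (norm_nonneg u) 3]

lemma sigmaFactor_neg_neg (w z : ℂ) :
    sigmaFactor (-w) (-z) = (if w = 0 then -1 else 1) * sigmaFactor w z := by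
  by_cases hw : w = 0 <;> simp [sigmaFactor, hw]

lemma differentiable_sigmaFactor (w : ℂ) : Differentiable ℂ (sigmaFactor w) := by
  unfold sigmaFactor
  split_ifs <;> fun_prop

lemma sigmaFactor_ne_zero {w z : ℂ} (h : z ≠ w) : sigmaFactor w z ≠ 0 := by
  unfold sigmaFactor
  split_ifs with hw
  · rwa [hw] at h
  · refine mul_ne_zero (sub_ne_zero.2 fun h' ↦ h ?_) (exp_ne_zero _)
    rw [eq_div_iff hw] at h'
    rw [← h', one_mul]

/-- Translating the point and the lattice point by `l` multiplies the factor by the exponential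
of a quadratic polynomial in `z`. -/
lemma sigmaFactor_add {l : ℂ} (hl : l ≠ 0) (w z : ℂ) :
    sigmaFactor (w + l) (z + l) =
      (if w = 0 then -l⁻¹ * exp (3 / 2) else if w + l = 0 then l else sigmaFactor (w + l) l) *
      exp (((w + l)⁻¹ - w⁻¹ + l * (w + l)⁻¹ ^ 2) * z + (((w + l)⁻¹ ^ 2 - w⁻¹ ^ 2) / 2) * z ^ 2) *
      sigmaFactor w z := by
  by_cases hw : w = 0
  · subst hw
    simp only [sigmaFactor, zero_add, if_true, hl, if_false, inv_zero]
    have e : (z + l) / l + (z + l) ^ 2 / (2 * l ^ 2) =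
        3 / 2 + ((l⁻¹ - 0 + l * l⁻¹ ^ 2) * z + ((l⁻¹ ^ 2 - 0 ^ 2) / 2) * z ^ 2) := by
      field_simp; ring
    rw [e, exp_add]
    field_simp
    ring
  by_cases hwl : w + l = 0
  · obtain rfl : w = -l := eq_neg_of_add_eq_zero_left hwl
    simp only [sigmaFactor, neg_add_cancel, if_true, neg_eq_zero, hl, if_false, inv_zero]
    have e : z / -l + z ^ 2 / (2 * (-l) ^ 2) =
        -((0 - (-l)⁻¹ + l * 0 ^ 2) * z + ((0 ^ 2 - (-l)⁻¹ ^ 2) / 2) * z ^ 2) := by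
      field_simp; ring
    rw [e, exp_neg]
    field_simp
    ring
  · simp only [sigmaFactor, hw, hwl, if_false]
    have e : (z + l) / (w + l) + (z + l) ^ 2 / (2 * (w + l) ^ 2) =
        (l / (w + l) + l ^ 2 / (2 * (w + l) ^ 2)) +
        (((w + l)⁻¹ - w⁻¹ + l * (w + l)⁻¹ ^ 2) * z + (((w + l)⁻¹ ^ 2 - w⁻¹ ^ 2) / 2) * z ^ 2) +
        (z / w + z ^ 2 / (2 * w ^ 2)) := by
      field_simp; ring
    have e' : 1 - (z + l) / (w + l) = (1 - l / (w + l)) * (1 - z / w) := by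
      field_simp; ring
    rw [e, e', exp_add, exp_add]
    ring

lemma mul_sq_le_add_cube {x y : ℝ} (hx : 0 ≤ x) (hy : 0 ≤ y) : x * y ^ 2 ≤ x ^ 3 + y ^ 3 := by
  rcases le_total x y with h | h
  · nlinarith [pow_nonneg hx 3, mul_le_mul_of_nonneg_right h (sq_nonneg y)]
  · nlinarith [pow_nonneg hy 3, mul_le_mul_of_nonneg_left (pow_le_pow_left₀ hy h 2) hx]

section Lattice

variable {ι : Type*} [AddCommGroup ι] (φ : ι →+ ℂ)

/-- The Weierstrass product over a family of lattice points given by an additive map. -/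
noncomputable def latticeSigma (z : ℂ) : ℂ := ∏' p, sigmaFactor (φ p) z

variable {φ}

lemma eventually_ne_of_injective (hφ : Function.Injective φ) (w : ℂ) :
    ∀ᶠ p in cofinite, φ p ≠ w :=
  Set.Subsingleton.finite fun _ ha _ hb ↦
    hφ ((not_not.1 ha).trans (not_not.1 hb).symm)

lemma eventually_norm_sigmaFactor_sub_one_le (hφ : Function.Injective φ)
    (hS : Summable fun p ↦ ‖(φ p)⁻¹‖ ^ 3) (R : ℝ) :
    ∀ᶠ p in cofinite, ∀ z : ℂ, ‖z‖ ≤ R →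
      ‖sigmaFactor (φ p) z - 1‖ ≤ 10 * R ^ 3 * ‖(φ p)⁻¹‖ ^ 3 := by
  have hlim : Tendsto (fun p ↦ R ^ 3 * ‖(φ p)⁻¹‖ ^ 3) cofinite (𝓝 0) := by
    simpa using hS.tendsto_cofinite_zero.const_mul (R ^ 3)
  filter_upwards [hlim.eventually_le_const (show (0 : ℝ) < (1 / 2) ^ 3 by norm_num),
    eventually_ne_of_injective hφ 0] with p hp hp0 z hz
  have hz' : ‖z / φ p‖ ≤ R * ‖(φ p)⁻¹‖ := by
    rw [div_eq_mul_inv, norm_mul]; gcongr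
  have hsmall : ‖z / φ p‖ ≤ 1 / 2 := by
    refine hz'.trans (le_of_pow_le_pow_left₀ three_ne_zero (by norm_num) ?_)
    rwa [mul_pow]
  have h := norm_elementaryFactor_sub_one_le hsmall
  rw [show z / φ p + (z / φ p) ^ 2 / 2 = z / φ p + z ^ 2 / (2 * φ p ^ 2) by field_simp] at h
  rw [sigmaFactor, if_neg hp0]
  calc _ ≤ _ := h
    _ ≤ 10 * (R * ‖(φ p)⁻¹‖) ^ 3 := by gcongr
    _ = _ := by ring

lemma summable_norm_sigmaFactor_sub_one (hφ : Function.Injective φ)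
    (hS : Summable fun p ↦ ‖(φ p)⁻¹‖ ^ 3) (z : ℂ) :
    Summable fun p ↦ ‖sigmaFactor (φ p) z - 1‖ := by
  refine Summable.of_norm_bounded_eventually (hS.mul_left (10 * ‖z‖ ^ 3)) ?_
  filter_upwards [eventually_norm_sigmaFactor_sub_one_le hφ hS ‖z‖] with p hp
  simpa using hp z le_rfl

lemma multipliable_sigmaFactor (hφ : Function.Injective φ)
    (hS : Summable fun p ↦ ‖(φ p)⁻¹‖ ^ 3) (z : ℂ) :
    Multipliable fun p ↦ sigmaFactor (φ p) z := by
  simpa using multipliable_one_add_of_summable (summable_norm_sigmaFactor_sub_one hφ hS z)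

lemma latticeSigma_ne_zero (hφ : Function.Injective φ)
    (hS : Summable fun p ↦ ‖(φ p)⁻¹‖ ^ 3) {z : ℂ} (hz : ∀ p, φ p ≠ z) :
    latticeSigma φ z ≠ 0 := by
  simpa [latticeSigma] using tprod_one_add_ne_zero_of_summable
    (fun p ↦ by simpa using sigmaFactor_ne_zero (hz p).symm)
    (summable_norm_sigmaFactor_sub_one hφ hS z)

lemma differentiable_latticeSigma (hφ : Function.Injective φ)
    (hS : Summable fun p ↦ ‖(φ p)⁻¹‖ ^ 3) : Differentiable ℂ (latticeSigma φ) := by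
  intro z
  have hprod : HasProdLocallyUniformlyOn (fun p x ↦ 1 + (sigmaFactor (φ p) x - 1))
      (fun x ↦ ∏' p, (1 + (sigmaFactor (φ p) x - 1))) (Metric.ball (0 : ℂ) (‖z‖ + 1)) := by
    refine (hS.mul_left (10 * (‖z‖ + 1) ^ 3)).hasProdLocallyUniformlyOn_one_add
      Metric.isOpen_ball ?_ fun p ↦
        ((differentiable_sigmaFactor _).sub_const 1).continuous.continuousOn
    filter_upwards [eventually_norm_sigmaFactor_sub_one_le hφ hS (‖z‖ + 1)] with p hp x hx
    exact hp x (mem_ball_zero_iff.1 hx).le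
  simp only [add_sub_cancel] at hprod
  refine (hprod.differentiableOn (.of_forall fun s ↦ ?_) Metric.isOpen_ball).differentiableAt
    (Metric.isOpen_ball.mem_nhds (by simp))
  simpa [Finset.prod_fn] using DifferentiableOn.finsetProd
    fun p _ ↦ (differentiable_sigmaFactor (φ p)).differentiableOn

lemma latticeSigma_neg (hφ : Function.Injective φ)
    (hS : Summable fun p ↦ ‖(φ p)⁻¹‖ ^ 3) (z : ℂ) :
    latticeSigma φ (-z) = -latticeSigma φ z := by
  classical
  have h0 (p : ι) : φ p = 0 ↔ p = 0 := map_eq_zero_iff φ hφ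
  have hsign : HasProd (fun p : ι ↦ if p = 0 then (-1 : ℂ) else 1) (-1) :=
    hasProd_ite_eq 0 (-1)
  calc latticeSigma φ (-z) = ∏' p, sigmaFactor (-φ p) (-z) := by
        rw [latticeSigma, ← (Equiv.neg ι).tprod_eq]
        simp
    _ = ∏' p, ((if p = 0 then -1 else 1) * sigmaFactor (φ p) z) := by
        simp only [sigmaFactor_neg_neg, h0]
    _ = -latticeSigma φ z := by
        rw [hsign.multipliable.tprod_mul (multipliable_sigmaFactor hφ hS z), hsign.tprod_eq,
          neg_one_mul, latticeSigma]

lemma latticeSigma_eq_mul_tprod (hφ : Function.Injective φ)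
    (hS : Summable fun p ↦ ‖(φ p)⁻¹‖ ^ 3) (z : ℂ) :
    latticeSigma φ z = z * ∏' p : {p : ι // p ≠ 0},
      (1 - z / φ p) * exp (z / φ p + z ^ 2 / (2 * φ p ^ 2)) := by
  have hsub : Multipliable fun p : {p : ι // p ≠ 0} ↦ sigmaFactor (φ p) z := by
    have hsum : Summable fun p : {p : ι // p ≠ 0} ↦ ‖sigmaFactor (φ p) z - 1‖ :=
      (summable_norm_sigmaFactor_sub_one hφ hS z).subtype {p | p ≠ 0}
    simpa using multipliable_one_add_of_summable hsum
  have hzero : HasProd ((fun p ↦ sigmaFactor (φ p) z) ∘ ((↑) : ({0} : Set ι) → ι)) z := by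
    simpa [sigmaFactor] using hasProd_unique ((fun p ↦ sigmaFactor (φ p) z) ∘
      ((↑) : ({0} : Set ι) → ι))
  rw [latticeSigma, (hzero.mul_compl hsub.hasProd).tprod_eq]
  congr 1
  refine tprod_congr fun p ↦ if_neg ?_
  simpa using (map_ne_zero_iff φ hφ).2 p.2

lemma exists_latticeSigma_add (hφ : Function.Injective φ)
    (hS : Summable fun p ↦ ‖(φ p)⁻¹‖ ^ 3) {q : ι} (hq : φ q ≠ 0) :
    ∃ C P Q : ℂ, ∀ z, latticeSigma φ (z + φ q) =
      C * exp (P * z + Q * z ^ 2) * latticeSigma φ z := by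
  set l := φ q
  have hshift {f : ι → ℝ} (hf : Summable f) : Summable fun p ↦ f (p + q) :=
    (Equiv.addRight q).summable_iff.2 hf
  have hne : ∀ᶠ p in cofinite, φ p ≠ 0 ∧ φ p + l ≠ 0 := by
    filter_upwards [eventually_ne_of_injective hφ 0, eventually_ne_of_injective hφ (-l)]
      with p h1 h2
    exact ⟨h1, fun h ↦ h2 (eq_neg_of_add_eq_zero_left h)⟩
  have hS' : Summable fun p ↦ ‖(φ p + l)⁻¹‖ ^ 3 := by
    simpa [l] using hshift hS
  have hP : Summable fun p ↦ (φ p + l)⁻¹ - (φ p)⁻¹ + l * (φ p + l)⁻¹ ^ 2 := by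
    refine Summable.of_norm_bounded_eventually ((hS.add hS').mul_left (‖l‖ ^ 2)) ?_
    filter_upwards [hne] with p ⟨h1, h2⟩
    rw [show (φ p + l)⁻¹ - (φ p)⁻¹ + l * (φ p + l)⁻¹ ^ 2 =
      -l ^ 2 * ((φ p)⁻¹ * (φ p + l)⁻¹ ^ 2) by field_simp; ring, norm_mul, norm_neg, norm_pow,
      norm_mul, norm_pow]
    gcongr
    exact mul_sq_le_add_cube (norm_nonneg _) (norm_nonneg _)
  have hQ : Summable fun p ↦ ((φ p + l)⁻¹ ^ 2 - (φ p)⁻¹ ^ 2) / 2 := by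
    refine Summable.of_norm_bounded_eventually ((hS.add hS').mul_left ‖l‖) ?_
    filter_upwards [hne] with p ⟨h1, h2⟩
    rw [show ((φ p + l)⁻¹ ^ 2 - (φ p)⁻¹ ^ 2) / 2 =
      -l / 2 * ((φ p)⁻¹ * (φ p + l)⁻¹ ^ 2 + (φ p + l)⁻¹ * (φ p)⁻¹ ^ 2) by field_simp; ring]
    have hsum : ‖(φ p)⁻¹ * (φ p + l)⁻¹ ^ 2 + (φ p + l)⁻¹ * (φ p)⁻¹ ^ 2‖ ≤
        2 * (‖(φ p)⁻¹‖ ^ 3 + ‖(φ p + l)⁻¹‖ ^ 3) := by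
      refine (norm_add_le _ _).trans ?_
      rw [norm_mul, norm_mul, norm_pow, norm_pow]
      linarith [mul_sq_le_add_cube (norm_nonneg (φ p)⁻¹) (norm_nonneg (φ p + l)⁻¹),
        mul_sq_le_add_cube (norm_nonneg (φ p + l)⁻¹) (norm_nonneg (φ p)⁻¹)]
    rw [norm_mul, norm_div, norm_neg, norm_ofNat]
    linarith [mul_le_mul_of_nonneg_left hsum (by positivity : 0 ≤ ‖l‖ / 2)]
  set c : ι → ℂ := fun p ↦ if φ p = 0 then -l⁻¹ * exp (3 / 2) else
    if φ p + l = 0 then l else sigmaFactor (φ p + l) l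
  have hc : Multipliable c := by
    have hsum : Summable fun p ↦ ‖c p - 1‖ := by
      have h := hshift (summable_norm_sigmaFactor_sub_one hφ hS l)
      refine Summable.of_norm_bounded_eventually h ?_
      filter_upwards [hne] with p ⟨h1, h2⟩
      simp [c, h1, h2, l]
    simpa using multipliable_one_add_of_summable hsum
  refine ⟨∏' p, c p, ∑' p, ((φ p + l)⁻¹ - (φ p)⁻¹ + l * (φ p + l)⁻¹ ^ 2),
    ∑' p, ((φ p + l)⁻¹ ^ 2 - (φ p)⁻¹ ^ 2) / 2, fun z ↦ ?_⟩
  have hexp := ((hP.hasSum.mul_right z).add (hQ.hasSum.mul_right (z ^ 2))).cexp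
  have h := (hc.hasProd.mul hexp).mul (multipliable_sigmaFactor hφ hS z).hasProd
  rw [latticeSigma, latticeSigma, ← h.tprod_eq, ← (Equiv.addRight q).tprod_eq]
  refine tprod_congr fun p ↦ ?_
  simpa [c, l] using sigmaFactor_add hq (φ p) z

theorem latticeSigma_add_period (hφ : Function.Injective φ)
    (hS : Summable fun p ↦ ‖(φ p)⁻¹‖ ^ 3) {q : ι} {ω : ℂ} (hq : φ q = 2 * ω)
    (hω : ∀ p, φ p ≠ ω) (z : ℂ) :
    latticeSigma φ (z + 2 * ω) =
      -exp (2 * (deriv (latticeSigma φ) ω / latticeSigma φ ω) * (z + ω)) * latticeSigma φ z := by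
  have hω0 : ω ≠ 0 := fun h ↦ hω 0 (by simp [h])
  have hdiff := differentiable_latticeSigma hφ hS
  have hodd := latticeSigma_neg hφ hS
  have hSω : latticeSigma φ ω ≠ 0 := latticeSigma_ne_zero hφ hS hω
  obtain ⟨C, P, Q, hCPQ⟩ := exists_latticeSigma_add hφ hS (q := q) (by simp [hq, hω0])
  rw [hq] at hCPQ
  set S := latticeSigma φ
  -- Comparing the shift at `x` with the shift at `-x - 2ω` shows that `Q` vanishes.
  have hQ : Q = 0 := by
    have hloc : (fun x ↦ C ^ 2 * exp (-P * (2 * ω) + Q * (x ^ 2 + (x + 2 * ω) ^ 2)))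
        =ᶠ[𝓝 ω] fun _ ↦ 1 := by
      filter_upwards [hdiff.continuous.continuousAt.eventually_ne hSω] with x hx
      have h1 := hCPQ x
      have h2 := hCPQ (-(x + 2 * ω))
      rw [show -(x + 2 * ω) + 2 * ω = -x by ring, hodd, hodd, h1] at h2
      refine mul_right_cancel₀ hx ?_
      rw [show -P * (2 * ω) + Q * (x ^ 2 + (x + 2 * ω) ^ 2) =
        (P * -(x + 2 * ω) + Q * (-(x + 2 * ω)) ^ 2) + (P * x + Q * x ^ 2) by ring, exp_add]
      linear_combination h2
    have hC : C ≠ 0 := by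
      rintro rfl
      simpa using hloc.self_of_nhds
    have hder : HasDerivAt
        (fun x ↦ C ^ 2 * exp (-P * (2 * ω) + Q * (x ^ 2 + (x + 2 * ω) ^ 2)))
        (C ^ 2 * (exp (-P * (2 * ω) + Q * (ω ^ 2 + (ω + 2 * ω) ^ 2)) * (Q * (8 * ω)))) ω := by
      refine HasDerivAt.const_mul _ (HasDerivAt.cexp (HasDerivAt.const_add _
        (HasDerivAt.const_mul _ ?_)))
      convert! ((hasDerivAt_id ω).pow 2).add (((hasDerivAt_id ω).add_const (2 * ω)).pow 2) using 1
      simp only [id]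
      push_cast
      ring
    have h0 := hder.unique ((hasDerivAt_const ω (1 : ℂ)).congr_of_eventuallyEq hloc)
    simpa [hC, hω0] using h0
  subst hQ
  simp only [zero_mul, add_zero] at hCPQ
  have hval : C * exp (P * -ω) = -1 := by
    have h := hCPQ (-ω)
    rw [show -ω + 2 * ω = ω by ring, hodd] at h
    refine mul_right_cancel₀ hSω ?_
    linear_combination h
  have hP : P = 2 * (deriv S ω / S ω) := by
    have hderω : HasDerivAt S (deriv S ω) ω := (hdiff ω).hasDerivAt
    have hderneg : HasDerivAt S (deriv S ω) (-ω) := by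
      have h := (HasDerivAt.scomp (-ω) (by rwa [neg_neg]) (hasDerivAt_neg (-ω))).neg
      simp only [neg_smul, one_smul, neg_neg] at h
      refine h.congr_of_eventuallyEq (.of_forall fun x ↦ ?_)
      simp [hodd]
    have hl : HasDerivAt (fun x ↦ S (x + 2 * ω)) (deriv S ω) (-ω) := by
      refine HasDerivAt.comp_add_const (-ω) (2 * ω) ?_
      rwa [show -ω + 2 * ω = ω by ring]
    have hr := (((hasDerivAt_id (-ω)).const_mul P).cexp.const_mul C).mul hderneg
    have h := hl.unique (hr.congr_of_eventuallyEq (.of_forall fun x ↦ by simp [hCPQ]))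
    simp only [id, hodd] at h
    rw [← mul_div_assoc, eq_div_iff hSω]
    linear_combination -h - (deriv S ω - P * S ω) * hval
  have hC : C = -exp (P * ω) := by
    have h : exp (P * -ω) * exp (P * ω) = 1 := by rw [← exp_add]; simp
    linear_combination -C * h + exp (P * ω) * hval
  rw [hCPQ z, ← hP, hC, mul_add, exp_add]
  ring

end Lattice

/-- `latticePoint` as an additive map. -/
noncomputable def latticePointHom (ω₁ ω₃ : ℂ) : ℤ × ℤ →+ ℂ where
  toFun := latticePoint ω₁ ω₃
  map_zero' := by simp [latticePoint]
  map_add' p q := by simp [latticePoint]; ring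

lemma linearIndependent_periods {ω₁ ω₃ : ℂ} (hω₁ : ω₁ ≠ 0) (hIm : 0 < (ω₃ / ω₁).im) :
    LinearIndependent ℝ ![2 * ω₁, 2 * ω₃] := by
  rw [LinearIndependent.pair_iff]
  intro s t h
  have h' : (s : ℂ) + t * (ω₃ / ω₁) = 0 := by
    simp only [real_smul] at h
    field_simp
    linear_combination h / 2
  have ht : t = 0 := by simpa [hIm.ne'] using congrArg Complex.im h'
  exact ⟨by simpa [ht] using h', ht⟩

lemma latticePointHom_eq {ω₁ ω₃ : ℂ} (h : LinearIndependent ℝ ![2 * ω₁, 2 * ω₃]) (p : ℤ × ℤ) :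
    latticePointHom ω₁ ω₃ p =
      ((PeriodPair.mk (2 * ω₁) (2 * ω₃) h).latticeEquivProd.symm p : ℂ) := by
  rw [PeriodPair.latticeEquiv_symm_apply]
  change latticePoint ω₁ ω₃ p = _
  simp only [latticePoint]
  ring

lemma latticePointHom_injective {ω₁ ω₃ : ℂ} (h : LinearIndependent ℝ ![2 * ω₁, 2 * ω₃]) :
    Function.Injective (latticePointHom ω₁ ω₃) := by
  intro p q hpq
  rw [latticePointHom_eq h, latticePointHom_eq h] at hpq
  exact (LinearEquiv.injective _) (Subtype.ext hpq)

lemma summable_norm_inv_latticePointHom {ω₁ ω₃ : ℂ}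
    (h : LinearIndependent ℝ ![2 * ω₁, 2 * ω₃]) :
    Summable fun p ↦ ‖(latticePointHom ω₁ ω₃ p)⁻¹‖ ^ 3 := by
  let L := PeriodPair.mk (2 * ω₁) (2 * ω₃) h
  have hL := ZLattice.summable_norm_rpow L.lattice (-3) (by rw [L.finrank_lattice]; norm_num)
  refine (L.latticeEquivProd.symm.toEquiv.summable_iff.2 hL).congr fun p ↦ ?_
  rw [latticePointHom_eq h, norm_inv, inv_pow, ← Real.rpow_natCast,
    ← Real.rpow_neg (norm_nonneg _)]
  simp [L]

lemma wSigma_eq_latticeSigma {ω₁ ω₃ : ℂ} (h : LinearIndependent ℝ ![2 * ω₁, 2 * ω₃]) :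
    wSigma ω₁ ω₃ = latticeSigma (latticePointHom ω₁ ω₃) := by
  ext z
  exact (latticeSigma_eq_mul_tprod (latticePointHom_injective h)
    (summable_norm_inv_latticePointHom h) z).symm

theorem wSigma_add_period {ω₁ ω₃ : ℂ} (h : LinearIndependent ℝ ![2 * ω₁, 2 * ω₃])
    {q : ℤ × ℤ} {ω : ℂ} (hq : latticePoint ω₁ ω₃ q = 2 * ω) (hodd : ∀ p, p + p ≠ q) (z : ℂ) :
    wSigma ω₁ ω₃ (z + 2 * ω) =
      -exp (2 * (deriv (wSigma ω₁ ω₃) ω / wSigma ω₁ ω₃ ω) * (z + ω)) * wSigma ω₁ ω₃ z := by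
  have hφ := latticePointHom_injective h
  rw [wSigma_eq_latticeSigma h]
  refine latticeSigma_add_period hφ (summable_norm_inv_latticePointHom h) (q := q) hq ?_ z
  refine fun p hp ↦ hodd p (hφ ?_)
  rw [map_add, hp, ← two_mul]
  exact hq.symm

lemma prod_shift_of_quasiPeriodic {S : ℂ → ℂ} {ω η : ℂ}
    (hS : ∀ z, S (z + 2 * ω) = -exp (2 * η * (z + ω)) * S z) (x₁ x₂ x₃ x₄ : ℂ) :
    S (x₁ + 2 * ω) * S (x₂ + 2 * ω) * S (x₃ + 2 * ω) * S (x₄ + 2 * ω) =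
      exp (2 * η * (x₁ + x₂ + x₃ + x₄ + 4 * ω)) * (S x₁ * S x₂ * S x₃ * S x₄) := by
  rw [hS x₁, hS x₂, hS x₃, hS x₄, show 2 * η * (x₁ + x₂ + x₃ + x₄ + 4 * ω) =
    2 * η * (x₁ + ω) + 2 * η * (x₂ + ω) + 2 * η * (x₃ + ω) + 2 * η * (x₄ + ω) by ring,
    exp_add, exp_add, exp_add]
  ring

lemma prod_shift_sub_of_quasiPeriodic {S : ℂ → ℂ} {ω η : ℂ}
    (hS : ∀ z, S (z + 2 * ω) = -exp (2 * η * (z + ω)) * S z) (x₁ x₂ x₃ x₄ : ℂ) :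
    S (x₁ + 2 * ω) * S (x₂ + 2 * ω) * S (x₃ + 2 * ω) * S (x₄ - 2 * ω) =
      exp (2 * η * (x₁ + x₂ + x₃ - x₄ + 4 * ω)) * (S x₁ * S x₂ * S x₃ * S x₄) := by
  have h₄ := hS (x₄ - 2 * ω)
  rw [sub_add_cancel] at h₄
  rw [hS x₁, hS x₂, hS x₃, h₄]
  have he : exp (2 * η * (x₁ + ω)) * exp (2 * η * (x₂ + ω)) * exp (2 * η * (x₃ + ω)) =
      exp (2 * η * (x₁ + x₂ + x₃ - x₄ + 4 * ω)) * exp (2 * η * (x₄ - 2 * ω + ω)) := by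
    simp only [← exp_add]
    congr 1
    ring
  linear_combination -(S x₁ * S x₂ * S x₃ * S (x₄ - 2 * ω)) * he

/-- The sum of three products of values of a quasi-periodic function is multiplied by an
exponential factor when `a` is translated by four half-periods. -/
lemma sum_prod_shift_of_quasiPeriodic {S : ℂ → ℂ} {ω η : ℂ}
    (hS : ∀ z, S (z + 2 * ω) = -exp (2 * η * (z + ω)) * S z) {b c d : ℂ} {F : ℂ → ℂ}
    (hF : ∀ a, F a = S a * S b * S c * S d +
      S ((a + b + c + d) / 2) * S ((a + b - c - d) / 2) *
        S ((a - b + c - d) / 2) * S ((-a + b + c - d) / 2) +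
      S ((a + b + c - d) / 2) * S ((a + b - c + d) / 2) *
        S ((a - b + c + d) / 2) * S ((a - b - c - d) / 2)) (a : ℂ) :
    F (a + 4 * ω) = exp (4 * η * a + 8 * η * ω) * F a := by
  have h₁ : S (a + 4 * ω) = exp (4 * η * a + 8 * η * ω) * S a := by
    rw [show a + 4 * ω = a + 2 * ω + 2 * ω by ring, hS, hS,
      show 4 * η * a + 8 * η * ω = 2 * η * (a + 2 * ω + ω) + 2 * η * (a + ω) by ring, exp_add]
    ring
  have h₂ := prod_shift_sub_of_quasiPeriodic hS ((a + b + c + d) / 2) ((a + b - c - d) / 2)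
    ((a - b + c - d) / 2) ((-a + b + c - d) / 2)
  have h₃ := prod_shift_of_quasiPeriodic hS ((a + b + c - d) / 2) ((a + b - c + d) / 2)
    ((a - b + c + d) / 2) ((a - b - c - d) / 2)
  ring_nf at h₁ h₂ h₃
  rw [hF, hF]
  ring_nf
  rw [h₁, h₂, h₃]
  ring

/-- quasi-periodicity of `φ₂` with respect to `4ω₁` and `4ω₃`. -/
theorem phi2_quasi_periodic
    (ω₁ ω₃ : ℂ) (hω₁ : ω₁ ≠ 0) (hω₃ : ω₃ ≠ 0) (hIm : 0 < (ω₃ / ω₁).im)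
    (b c d : ℂ)
    (φ₂ : ℂ → ℂ)
    (hφ₂ : ∀ a : ℂ, φ₂ a =
      wSigma ω₁ ω₃ a * wSigma ω₁ ω₃ b * wSigma ω₁ ω₃ c * wSigma ω₁ ω₃ d +
      wSigma ω₁ ω₃ ((a + b + c + d) / 2) * wSigma ω₁ ω₃ ((a + b - c - d) / 2) *
        wSigma ω₁ ω₃ ((a - b + c - d) / 2) * wSigma ω₁ ω₃ ((-a + b + c - d) / 2) +
      wSigma ω₁ ω₃ ((a + b + c - d) / 2) * wSigma ω₁ ω₃ ((a + b - c + d) / 2) *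
        wSigma ω₁ ω₃ ((a - b + c + d) / 2) * wSigma ω₁ ω₃ ((a - b - c - d) / 2)) :
    (∀ a : ℂ, φ₂ (a + 4 * ω₁) =
        Complex.exp (4 * wEta ω₁ ω₃ 1 * a + 8 * wEta ω₁ ω₃ 1 * ω₁) * φ₂ a) ∧
    (∀ a : ℂ, φ₂ (a + 4 * ω₃) =
        Complex.exp (4 * wEta ω₁ ω₃ 3 * a + 8 * wEta ω₁ ω₃ 3 * ω₃) * φ₂ a) := by
  have h := linearIndependent_periods hω₁ hIm
  refine ⟨sum_prod_shift_of_quasiPeriodic (wSigma_add_period h (q := (1, 0)) ?_ ?_) hφ₂,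
    sum_prod_shift_of_quasiPeriodic (wSigma_add_period h (q := (0, 1)) ?_ ?_) hφ₂⟩
  · simp [latticePoint]
  · rintro ⟨m, n⟩ hp
    have := congrArg Prod.fst hp
    simp only [Prod.mk_add_mk] at this
    omega
  · simp [latticePoint]
  · rintro ⟨m, n⟩ hp
    have := congrArg Prod.snd hp
    simp only [Prod.mk_add_mk] at this
    omega
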